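/- For each n ≥ 1, the free n-generator unital ℓ-group (M_n, 1) is hopfian: every surjective unital ℓ-endomorphism of (M_n, 1) is injective. -/

import Mathlib

open Set BigOperators

/-- The unit cube `[0,1]^n` as a subset of `Fin n → ℝ`. -/
def cube (n : ℕ) : Set (Fin n → ℝ) := Set.Icc 0 1

/-- An (affine) linear polynomial with integer coefficients. -/
def IsAffineZ {n : ℕ} (p : (Fin n → ℝ) → ℝ) : Prop :=
  ∃ (m : ℤ) (c : Fin n → ℤ), ∀ x, p x = (m : ℝ) + ∑ i, (c i : ℝ) * x i

/-- An element of `M_n`: a continuous real-valued function on `[0,1]^n` that agrees at each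
point of the cube with one of finitely many affine polynomials with integer coefficients. -/
def IsPWLZ {n : ℕ} (f : (Fin n → ℝ) → ℝ) : Prop :=
  ContinuousOn f (cube n) ∧
  ∃ (u : ℕ) (p : Fin u → (Fin n → ℝ) → ℝ),
    (∀ j, IsAffineZ (p j)) ∧ ∀ x ∈ cube n, ∃ j, f x = p j x

/-- `Mres X = M_n↾X`: restrictions to `X` of elements of `M_n`. -/
def Mres {n : ℕ} (X : Set (Fin n → ℝ)) : Set (↥X → ℝ) :=
  {g : ↥X → ℝ | ∃ f, IsPWLZ (n := n) f ∧ ∀ x : X, g x = f x.1}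

/-- A unital ℓ-endomorphism of `(M_n↾X, 1)`: preserves `+`, `⊔`, `⊓` (pointwise) and the
unit (the constant function `1`). -/
def IsUnitalLEndo {n : ℕ} (X : Set (Fin n → ℝ)) (σ : (↥X → ℝ) → (↥X → ℝ)) : Prop :=
  Set.MapsTo σ (Mres X) (Mres X) ∧
  (∀ f ∈ Mres X, ∀ g ∈ Mres X, σ (f + g) = σ f + σ g) ∧
  (∀ f ∈ Mres X, ∀ g ∈ Mres X, σ (f ⊔ g) = σ f ⊔ σ g) ∧
  (∀ f ∈ Mres X, ∀ g ∈ Mres X, σ (f ⊓ g) = σ f ⊓ σ g) ∧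
  σ 1 = 1

/-- A point all of whose coordinates are rational. -/
def IsRationalPoint {n : ℕ} (x : Fin n → ℝ) : Prop := ∀ i, ∃ q : ℚ, x i = (q : ℝ)

theorem isPWLZ_of_finite {n : ℕ} {f : (Fin n → ℝ) → ℝ} (hf : ContinuousOn f (cube n))
    {s : Set ((Fin n → ℝ) → ℝ)} (hs : s.Finite) (haff : ∀ p ∈ s, IsAffineZ p)
    (hmem : ∀ x ∈ cube n, ∃ p ∈ s, f x = p x) : IsPWLZ f := by
  obtain ⟨u, e, -, rfl⟩ := hs.fin_param
  exact ⟨hf, u, e, fun j => haff _ ⟨j, rfl⟩, fun x hx => by simpa using hmem x hx⟩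

theorem IsPWLZ.exists_finite {n : ℕ} {f : (Fin n → ℝ) → ℝ} (hf : IsPWLZ f) :
    ∃ s : Set ((Fin n → ℝ) → ℝ), s.Finite ∧ (∀ p ∈ s, IsAffineZ p) ∧
      ∀ x ∈ cube n, ∃ p ∈ s, f x = p x := by
  obtain ⟨-, u, p, hp, hx⟩ := hf
  refine ⟨range p, finite_range p, ?_, fun x h => ?_⟩
  · rintro _ ⟨j, rfl⟩
    exact hp j
  · obtain ⟨j, hj⟩ := hx x h
    exact ⟨p j, ⟨j, rfl⟩, hj⟩

theorem IsAffineZ.add {n : ℕ} {p q : (Fin n → ℝ) → ℝ} (hp : IsAffineZ p) (hq : IsAffineZ q) :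
    IsAffineZ (p + q) := by
  obtain ⟨m, c, h⟩ := hp
  obtain ⟨m', c', h'⟩ := hq
  refine ⟨m + m', c + c', fun x => ?_⟩
  simp only [Pi.add_apply, h, h', Int.cast_add, add_mul, Finset.sum_add_distrib]
  ring

theorem IsAffineZ.neg {n : ℕ} {p : (Fin n → ℝ) → ℝ} (hp : IsAffineZ p) : IsAffineZ (-p) := by
  obtain ⟨m, c, h⟩ := hp
  refine ⟨-m, -c, fun x => ?_⟩
  simp only [Pi.neg_apply, h, Int.cast_neg, neg_mul, Finset.sum_neg_distrib]
  ring

theorem IsAffineZ.isPWLZ {n : ℕ} {p : (Fin n → ℝ) → ℝ} (hp : IsAffineZ p) : IsPWLZ p := by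
  refine ⟨?_, 1, fun _ => p, fun _ => hp, fun x _ => ⟨0, rfl⟩⟩
  obtain ⟨m, c, h⟩ := hp
  obtain rfl : p = fun x => (m : ℝ) + ∑ i, (c i : ℝ) * x i := funext h
  fun_prop

theorem IsPWLZ.add {n : ℕ} {f g : (Fin n → ℝ) → ℝ} (hf : IsPWLZ f) (hg : IsPWLZ g) :
    IsPWLZ (f + g) := by
  obtain ⟨s, hs, hsa, hsx⟩ := hf.exists_finite
  obtain ⟨t, ht, hta, htx⟩ := hg.exists_finite
  refine isPWLZ_of_finite (hf.1.add hg.1) (hs.image2 (· + ·) ht) ?_ fun x hx => ?_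
  · rintro _ ⟨p, hp, q, hq, rfl⟩
    exact (hsa p hp).add (hta q hq)
  · obtain ⟨p, hp, hpx⟩ := hsx x hx
    obtain ⟨q, hq, hqx⟩ := htx x hx
    exact ⟨p + q, mem_image2_of_mem hp hq, by simp [hpx, hqx]⟩

theorem IsPWLZ.neg {n : ℕ} {f : (Fin n → ℝ) → ℝ} (hf : IsPWLZ f) : IsPWLZ (-f) := by
  obtain ⟨s, hs, hsa, hsx⟩ := hf.exists_finite
  refine isPWLZ_of_finite hf.1.neg (hs.image (- ·)) ?_ fun x hx => ?_
  · rintro _ ⟨p, hp, rfl⟩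
    exact (hsa p hp).neg
  · obtain ⟨p, hp, hpx⟩ := hsx x hx
    exact ⟨-p, mem_image_of_mem _ hp, by simp [hpx]⟩

theorem IsPWLZ.sup {n : ℕ} {f g : (Fin n → ℝ) → ℝ} (hf : IsPWLZ f) (hg : IsPWLZ g) :
    IsPWLZ (f ⊔ g) := by
  obtain ⟨s, hs, hsa, hsx⟩ := hf.exists_finite
  obtain ⟨t, ht, hta, htx⟩ := hg.exists_finite
  refine isPWLZ_of_finite (hf.1.sup hg.1) (hs.union ht) ?_ fun x hx => ?_
  · rintro p (hp | hp)
    exacts [hsa p hp, hta p hp]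
  · obtain ⟨p, hp, hpx⟩ := hsx x hx
    obtain ⟨q, hq, hqx⟩ := htx x hx
    rcases le_total (f x) (g x) with h | h
    · exact ⟨q, Or.inr hq, by simp [← hqx, h]⟩
    · exact ⟨p, Or.inl hp, by simp [← hpx, h]⟩

/-- The group `M_n`, as an additive subgroup of the functions on the cube. -/
def MresSubgroup (n : ℕ) : AddSubgroup (↥(cube n) → ℝ) where
  carrier := Mres (cube n)
  add_mem' := by
    rintro _ _ ⟨f, hf, hf'⟩ ⟨g, hg, hg'⟩
    exact ⟨f + g, hf.add hg, fun x => by simp [hf', hg']⟩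
  zero_mem' := ⟨0, IsAffineZ.isPWLZ ⟨0, 0, by simp⟩, fun x => by simp⟩
  neg_mem' := by
    rintro _ ⟨f, hf, hf'⟩
    exact ⟨-f, hf.neg, fun x => by simp [hf']⟩

theorem sup_mem_MresSubgroup {n : ℕ} {f g : ↥(cube n) → ℝ} (hf : f ∈ MresSubgroup n)
    (hg : g ∈ MresSubgroup n) : f ⊔ g ∈ MresSubgroup n := by
  obtain ⟨f', hf, hf'⟩ := hf
  obtain ⟨g', hg, hg'⟩ := hg
  exact ⟨f' ⊔ g', hf.sup hg, fun x => by simp [hf', hg']⟩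

theorem one_mem_MresSubgroup (n : ℕ) : (1 : ↥(cube n) → ℝ) ∈ MresSubgroup n :=
  ⟨1, IsAffineZ.isPWLZ ⟨1, 0, by simp⟩, fun x => by simp⟩

theorem coord_mem_MresSubgroup {n : ℕ} (i : Fin n) :
    (fun x : cube n => x.1 i) ∈ MresSubgroup n :=
  ⟨fun x => x i, IsAffineZ.isPWLZ ⟨0, Pi.single i 1, by simp [Pi.single_apply]⟩, fun _ => rfl⟩

theorem continuous_of_mem_MresSubgroup {n : ℕ} {f : ↥(cube n) → ℝ} (hf : f ∈ MresSubgroup n) :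
    Continuous f := by
  obtain ⟨g, hg, hfg⟩ := hf
  rw [funext hfg]
  exact hg.1.domRestrict

/-- The points of the cube whose coordinates are integer multiples of `1 / d`. -/
def cubeGrid (n d : ℕ) : Set (cube n) := {x | ∀ i, ∃ k : ℤ, d * x.1 i = k}

theorem finite_cubeGrid (n : ℕ) {d : ℕ} (hd : 0 < d) : (cubeGrid n d).Finite := by
  have hd' : (0 : ℝ) < d := by exact_mod_cast hd
  have hfin : ((fun (k : Fin n → ℤ) i => (k i : ℝ) / d) ''
      Set.Icc 0 (fun _ => (d : ℤ))).Finite := (Set.finite_Icc _ _).image _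
  refine (hfin.preimage Subtype.val_injective.injOn).subset fun x hx => ?_
  choose k hk using hx
  refine ⟨k, ⟨fun i => ?_, fun i => ?_⟩, funext fun i => ?_⟩
  · have h0 : (0 : ℝ) ≤ x.1 i := x.2.1 i
    have : (0 : ℝ) ≤ k i := by rw [← hk]; positivity
    simpa using (by exact_mod_cast this : 0 ≤ k i)
  · have h1 : x.1 i ≤ 1 := x.2.2 i
    have : (k i : ℝ) ≤ d := by rw [← hk]; nlinarith
    exact_mod_cast this
  · simp only [← hk]
    field_simp

theorem exists_int_of_mem_cubeGrid {n d : ℕ} {x : cube n} (hx : x ∈ cubeGrid n d)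
    {f : ↥(cube n) → ℝ} (hf : f ∈ MresSubgroup n) : ∃ k : ℤ, d * f x = k := by
  obtain ⟨g, ⟨-, u, p, hp, hgp⟩, hfg⟩ := hf
  obtain ⟨j, hj⟩ := hgp x.1 x.2
  obtain ⟨m, c, hmc⟩ := hp j
  choose k hk using hx
  refine ⟨d * m + ∑ i, c i * k i, ?_⟩
  rw [hfg, hj, hmc, mul_add, Finset.mul_sum]
  push_cast
  congr 1
  exact Finset.sum_congr rfl fun i _ => by rw [← hk]; ring

theorem eq_of_eqOn_cubeGrid {n : ℕ} {f g : ↥(cube n) → ℝ} (hf : Continuous f) (hg : Continuous g)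
    (h : ∀ d, 0 < d → EqOn f g (cubeGrid n d)) : f = g := by
  funext x
  have hx0 : ∀ i, 0 ≤ x.1 i := x.2.1
  have hx1 : ∀ i, x.1 i ≤ 1 := x.2.2
  let y : ℕ → cube n := fun d => ⟨fun i => (⌊x.1 i * d⌋₊ : ℝ) / d, fun i => by
    change (0 : ℝ) ≤ _
    positivity, fun i => by
    change _ ≤ (1 : ℝ)
    refine div_le_one_of_le₀ ((Nat.floor_le (mul_nonneg (hx0 i) d.cast_nonneg)).trans ?_)
      d.cast_nonneg
    exact mul_le_of_le_one_left d.cast_nonneg (hx1 i)⟩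
  have hy : Filter.Tendsto y Filter.atTop (nhds x) := by
    rw [tendsto_subtype_rng, tendsto_pi_nhds]
    exact fun i => (tendsto_nat_floor_mul_div_atTop (hx0 i)).comp tendsto_natCast_atTop_atTop
  refine tendsto_nhds_unique ((hf.tendsto x).comp hy) (((hg.tendsto x).comp hy).congr' ?_)
  filter_upwards [Filter.eventually_gt_atTop 0] with d hd
  refine (h d hd fun i => ⟨⌊x.1 i * d⌋₊, ?_⟩).symm
  have hd' : (d : ℝ) ≠ 0 := by exact_mod_cast hd.ne'
  simp only [y, Int.cast_natCast]
  field_simp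

/-- A nonnegative function annihilated by some unital ℓ-homomorphism `M_n → ℝ` vanishes
somewhere. -/
theorem exists_eq_zero_of_map_eq_zero {n : ℕ} (φ : MresSubgroup n →+ ℝ)
    (hsup : ∀ (f g : MresSubgroup n),
      φ ⟨f.1 ⊔ g.1, sup_mem_MresSubgroup f.2 g.2⟩ = φ f ⊔ φ g)
    (hone : φ ⟨1, one_mem_MresSubgroup n⟩ = 1) (h : MresSubgroup n) (h0 : ∀ x, 0 ≤ h.1 x)
    (hφ : φ h = 0) : ∃ x, h.1 x = 0 := by
  by_contra! hne
  have : CompactSpace (cube n) := isCompact_iff_compactSpace.mp isCompact_Icc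
  have : Nonempty (cube n) := ⟨⟨0, le_rfl, zero_le_one⟩⟩
  obtain ⟨x, -, hx⟩ := isCompact_univ.exists_isMinOn univ_nonempty
    (continuous_of_mem_MresSubgroup h.2).continuousOn
  simp only [isMinOn_iff, mem_univ, true_implies] at hx
  obtain ⟨N, hN⟩ := exists_nat_gt (1 / h.1 x)
  have hpos : 0 < h.1 x := lt_of_le_of_ne (h0 x) (hne x).symm
  have key := hsup (N • h) ⟨1, one_mem_MresSubgroup n⟩
  have hmax : (⟨(N • h).1 ⊔ 1, sup_mem_MresSubgroup (N • h).2 (one_mem_MresSubgroup n)⟩ :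
      MresSubgroup n) = N • h := by
    refine Subtype.ext (sup_eq_left.mpr fun y => ?_)
    rw [div_lt_iff₀ hpos] at hN
    have : (N : ℝ) * h.1 x ≤ N * h.1 y := mul_le_mul_of_nonneg_left (hx y) N.cast_nonneg
    simpa using hN.le.trans this
  rw [hmax, map_nsmul, hφ, hone] at key
  norm_num at key

/-- A unital ℓ-homomorphism `M_n → ℝ` with values in `(1 / d) ℤ` is evaluation at the point of the
cube whose coordinates are the images of the coordinate functions. -/
theorem exists_eval_of_int_values {n d : ℕ} (hd : 0 < d) (φ : MresSubgroup n →+ ℝ)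
    (hsup : ∀ (f g : MresSubgroup n),
      φ ⟨f.1 ⊔ g.1, sup_mem_MresSubgroup f.2 g.2⟩ = φ f ⊔ φ g)
    (hone : φ ⟨1, one_mem_MresSubgroup n⟩ = 1) (hval_int : ∀ f, ∃ k : ℤ, d * φ f = k) :
    ∃ a : cube n, ∀ f, φ f = f.1 a := by
  have hd' : (d : ℝ) ≠ 0 := by exact_mod_cast hd.ne'
  choose k hk using hval_int
  let r : MresSubgroup n → MresSubgroup n := fun f =>
    d • f - k f • ⟨1, one_mem_MresSubgroup n⟩
  have hr : ∀ f, φ (r f) = 0 := fun f => by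
    simp only [r, map_sub, map_nsmul, map_zsmul, hone, nsmul_eq_mul, zsmul_eq_mul, hk]
    ring
  let A : MresSubgroup n → MresSubgroup n := fun f =>
    ⟨(r f).1 ⊔ (-r f).1, sup_mem_MresSubgroup (r f).2 (-r f).2⟩
  have hA : ∀ f, φ (A f) = 0 := fun f => by
    simp only [A, hsup (r f) (-r f), map_neg, hr, neg_zero, sup_idem]
  have hAx : ∀ f x, (A f).1 x = |d * f.1 x - d * φ f| := fun f x => by
    simp [A, r, abs, hk]
  have hA0 : ∀ f x, (A f).1 x = 0 → f.1 x = φ f := fun f x h => by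
    rw [hAx, abs_eq_zero, sub_eq_zero] at h
    exact mul_left_cancel₀ hd' h
  have hpoint (f : MresSubgroup n) : ∃ x : cube n, f.1 x = φ f ∧
      ∀ i, x.1 i = φ ⟨_, coord_mem_MresSubgroup i⟩ := by
    have hval : ∀ x, (A f + ∑ i, A ⟨_, coord_mem_MresSubgroup i⟩ : MresSubgroup n).1 x =
        (A f).1 x + ∑ i, (A ⟨_, coord_mem_MresSubgroup i⟩).1 x := fun x => by
      simp
    have hnn : ∀ f x, 0 ≤ (A f).1 x := fun f x => by rw [hAx]; exact abs_nonneg _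
    have hsnn : ∀ x, 0 ≤ ∑ i, (A ⟨_, coord_mem_MresSubgroup i⟩).1 x := fun x =>
      Finset.sum_nonneg fun i _ => hnn _ x
    obtain ⟨x, hx⟩ := exists_eq_zero_of_map_eq_zero φ hsup hone
      (A f + ∑ i, A ⟨_, coord_mem_MresSubgroup i⟩)
      (fun x => by rw [hval]; exact add_nonneg (hnn f x) (hsnn x))
      (by simp [hA])
    rw [hval, add_eq_zero_iff_of_nonneg (hnn f x) (hsnn x),
      Finset.sum_eq_zero_iff_of_nonneg fun i _ => hnn _ x] at hx
    exact ⟨x, hA0 f x hx.1, fun i => hA0 _ x (hx.2 i (Finset.mem_univ i))⟩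
  obtain ⟨a, -, ha⟩ := hpoint 0
  refine ⟨a, fun f => ?_⟩
  obtain ⟨x, hx, hxi⟩ := hpoint f
  obtain rfl : x = a := Subtype.ext (funext fun i => (hxi i).trans (ha i).symm)
  exact hx.symm

theorem IsUnitalLEndo.exists_eval {n d : ℕ} (hd : 0 < d) {σ : (↥(cube n) → ℝ) → (↥(cube n) → ℝ)}
    (hσ : IsUnitalLEndo (cube n) σ) {x : cube n} (hx : x ∈ cubeGrid n d) :
    ∃ a : cube n, ∀ f ∈ MresSubgroup n, σ f x = f a := by
  obtain ⟨hmaps, hadd, hsup, -, hone⟩ := hσ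
  let φ : MresSubgroup n →+ ℝ := AddMonoidHom.mk' (fun f => σ f.1 x) fun f g => by
    simp [hadd f.1 f.2 g.1 g.2]
  obtain ⟨a, ha⟩ := exists_eval_of_int_values hd φ
    (fun f g => congrFun (hsup f.1 f.2 g.1 g.2) x) (congrFun hone x)
    (fun f => exists_int_of_mem_cubeGrid hx (hmaps f.2))
  exact ⟨a, fun f hf => ha ⟨f, hf⟩⟩

/-- for each `n ≥ 1`, the free `n`-generator unital ℓ-group `(M_n, 1)` is
hopfian: every surjective unital ℓ-endomorphism of `(M_n, 1)` is injective. -/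
theorem stmt6 {n : ℕ} (hn : 1 ≤ n) :
    ∀ σ : (↥(cube n) → ℝ) → (↥(cube n) → ℝ), IsUnitalLEndo (cube n) σ →
      Set.SurjOn σ (Mres (cube n)) (Mres (cube n)) → Set.InjOn σ (Mres (cube n)) := by
  intro σ hσ hsurj f hf g hg hfg
  refine eq_of_eqOn_cubeGrid (continuous_of_mem_MresSubgroup hf)
    (continuous_of_mem_MresSubgroup hg) fun d hd => ?_
  choose η hη using fun x : cubeGrid n d => hσ.exists_eval hd x.2
  have hmem : ∀ x, η x ∈ cubeGrid n d := fun x i => by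
    rw [← hη x _ (coord_mem_MresSubgroup i)]
    exact exists_int_of_mem_cubeGrid x.2 (hσ.1 (coord_mem_MresSubgroup i))
  have : Finite (cubeGrid n d) := finite_cubeGrid n hd
  have hinj : Function.Injective fun x => (⟨η x, hmem x⟩ : cubeGrid n d) := fun x y hxy => by
    refine Subtype.ext (Subtype.ext (funext fun i => ?_))
    obtain ⟨p, hp, hpi⟩ := hsurj (coord_mem_MresSubgroup i)
    have hx := hη x p hp
    have hy := hη y p hp
    rw [hpi] at hx hy
    exact hx.trans ((congrArg p (Subtype.mk.inj hxy)).trans hy.symm)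
  intro y hy
  obtain ⟨x, hx⟩ := Finite.surjective_of_injective hinj ⟨y, hy⟩
  obtain rfl : η x = y := congrArg Subtype.val hx
  rw [← hη x f hf, ← hη x g hg, hfg]
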